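/- Let β ≥ 2 be an integer, λ > 1 and let r ≥ 2 be an integer. Let v : ℝ → ℝ be C^{r+1} with v(x + 2πβ) = v(x) + 2π for all x, 0 < v'(x) ≤ λ⁻¹ for all x, and sup_x |v^{(n+1)}(x)/v'(x)| ≤ C_n < ∞ for n = 1,…,r. Define the transfer operator on 2π-periodic functions by (Lφ)(x) = Σ_{b=0}^{β−1} v'(x + 2πb) φ(v(x + 2πb)). Then there exists C > 0 such that for every N ≥ 1 and every trigonometric polynomial φ of degree at most N: ‖Lφ − P_N(Lφ)‖_BV ≤ C · N^{3/2} (1 + N)^{−r} · ‖φ‖_BV. -/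

import Mathlib

/-- The `j`-th Fourier coefficient of a `2π`-periodic function `φ : ℝ → ℂ`. -/
noncomputable def fCoeff (φ : ℝ → ℂ) (j : ℤ) : ℂ :=
  (1 / (2 * Real.pi) : ℂ) * ∫ x in (0 : ℝ)..(2 * Real.pi),
    φ x * Complex.exp (-Complex.I * (j : ℂ) * (x : ℂ))

/-- The `N`-th Fourier truncation `P_N φ = Σ_{|j| ≤ N} φ̂(j) e^{ijx}`. -/
noncomputable def fTrunc (N : ℕ) (φ : ℝ → ℂ) : ℝ → ℂ := fun x =>
  ∑ j ∈ Finset.Icc (-(N : ℤ)) (N : ℤ), fCoeff φ j * Complex.exp (Complex.I * (j : ℂ) * (x : ℂ))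

/-- The BV norm of a `2π`-periodic function:
`‖φ‖_BV = sup_{[0,2π]} |φ| + Var_{[0,2π]} φ`. -/
noncomputable def bvNorm (φ : ℝ → ℂ) : ℝ :=
  (⨆ x : Set.Icc (0 : ℝ) (2 * Real.pi), ‖φ (x : ℝ)‖) +
    (eVariationOn φ (Set.Icc 0 (2 * Real.pi))).toReal

/-- The transfer operator `(L φ)(x) = Σ_{b=0}^{β-1} v'(x + 2πb) φ(v(x + 2πb))` of a
degree-`β` expanding circle map with inverse lift `v`. -/
noncomputable def transferOp (β : ℕ) (v : ℝ → ℝ) (φ : ℝ → ℂ) : ℝ → ℂ := fun x =>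
  ∑ b ∈ Finset.range β,
    ((deriv v (x + 2 * Real.pi * b) : ℝ) : ℂ) * φ (v (x + 2 * Real.pi * b))

/-- `φ` is a trigonometric polynomial of degree at most `N`. -/
def IsTrigPoly (N : ℕ) (φ : ℝ → ℂ) : Prop :=
  ∃ c : ℤ → ℂ, φ = fun x : ℝ =>
    ∑ j ∈ Finset.Icc (-(N : ℤ)) (N : ℤ), c j * Complex.exp (Complex.I * (j : ℂ) * (x : ℂ))

open MeasureTheory Set Filter Topology in
/-- The oscillation of a `C¹` function is bounded by the integral of its derivative. -/
lemma norm_sub_le_integral_norm_deriv {h h' : ℝ → ℂ} (hh : ∀ x, HasDerivAt h (h' x) x)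
    (hc : Continuous h') {a b x y : ℝ} (hx : x ∈ Icc a b) (hy : y ∈ Icc a b) :
    ‖h x - h y‖ ≤ ∫ t in a..b, ‖h' t‖ := by
  have hab : a ≤ b := hx.1.trans hx.2
  rw [← intervalIntegral.integral_eq_sub_of_hasDerivAt (fun t _ => hh t)
    (hc.intervalIntegrable y x)]
  refine (intervalIntegral.norm_integral_le_abs_integral_norm).trans ?_
  refine intervalIntegral.abs_integral_mono_interval (a := y) (b := x) (c := a) (d := b) ?_ ?_ ?_
    |>.trans_eq (abs_of_nonneg ?_)
  · rw [uIoc_of_le hab]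
    exact Ioc_subset_Ioc (le_min hy.1 hx.1) (max_le hy.2 hx.2)
  · exact ae_of_all _ fun t => norm_nonneg _
  · exact hc.norm.intervalIntegrable _ _
  · exact intervalIntegral.integral_nonneg hab fun t _ => norm_nonneg _

open MeasureTheory Set in
/-- The total variation of a `C¹` function is bounded by the integral of its derivative. -/
lemma eVariationOn_le_integral_norm_deriv {h h' : ℝ → ℂ} (hh : ∀ x, HasDerivAt h (h' x) x)
    (hc : Continuous h') {a b : ℝ} (hab : a ≤ b) :
    eVariationOn h (Icc a b) ≤ ENNReal.ofReal (∫ t in a..b, ‖h' t‖) := by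
  set G : ℝ → ℝ := fun x => ∫ t in a..x, ‖h' t‖ with hG
  have hII : ∀ x y, IntervalIntegrable (fun t => ‖h' t‖) volume x y :=
    fun x y => hc.norm.intervalIntegrable _ _
  have hGsub : ∀ x y, G y - G x = ∫ t in x..y, ‖h' t‖ := fun x y =>
    intervalIntegral.integral_interval_sub_left (hII _ _) (hII _ _)
  have hmono : MonotoneOn G (Icc a b) := by
    intro x _ y _ hxy
    have := intervalIntegral.integral_nonneg (μ := volume) (f := fun t => ‖h' t‖) hxy
      fun t _ => norm_nonneg _
    rw [← hGsub] at this
    linarith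
  have h1 : eVariationOn h (Icc a b) ≤ eVariationOn G (Icc a b) := by
    refine iSup_mono fun p => Finset.sum_le_sum fun i _ => ?_
    have hp : p.2.1 i ≤ p.2.1 (i + 1) := p.2.2.1 (Nat.le_succ i)
    rw [edist_dist, edist_dist]
    refine ENNReal.ofReal_le_ofReal ?_
    rw [dist_eq_norm, Real.dist_eq, hGsub]
    exact (norm_sub_le_integral_norm_deriv hh hc (right_mem_Icc.2 hp) (left_mem_Icc.2 hp)).trans
      (le_abs_self _)
  have h2 := hmono.eVariationOn_eq (left_mem_Icc.2 hab) (right_mem_Icc.2 hab)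
  rw [inter_self, hGsub] at h2
  exact h1.trans h2.le

open MeasureTheory Set in
/-- The BV norm of a mean-zero `C¹` function is controlled by the `L¹` norm of its derivative. -/
lemma bvNorm_le_integral_norm_deriv {h h' : ℝ → ℂ} (hh : ∀ x, HasDerivAt h (h' x) x)
    (hc : Continuous h') (h0 : ∫ x in (0 : ℝ)..(2 * Real.pi), h x = 0) :
    bvNorm h ≤ 2 * ∫ t in (0 : ℝ)..(2 * Real.pi), ‖h' t‖ := by
  have hpi := Real.two_pi_pos
  set V := ∫ t in (0 : ℝ)..(2 * Real.pi), ‖h' t‖ with hV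
  have hV0 : 0 ≤ V := intervalIntegral.integral_nonneg hpi.le fun t _ => norm_nonneg _
  have hcont : Continuous h := continuous_iff_continuousAt.2 fun x => (hh x).continuousAt
  have hvar : (eVariationOn h (Icc 0 (2 * Real.pi))).toReal ≤ V :=
    ENNReal.toReal_le_of_le_ofReal hV0 (eVariationOn_le_integral_norm_deriv hh hc hpi.le)
  have hsup : (⨆ x : Icc (0 : ℝ) (2 * Real.pi), ‖h (x : ℝ)‖) ≤ V := by
    have : Nonempty (Icc (0 : ℝ) (2 * Real.pi)) := ⟨⟨0, left_mem_Icc.2 hpi.le⟩⟩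
    refine ciSup_le fun x => ?_
    have e : ∫ y in (0 : ℝ)..(2 * Real.pi), (h x - h y) = (2 * Real.pi : ℝ) • h x := by
      rw [intervalIntegral.integral_sub (by simp) (hcont.intervalIntegrable _ _), h0]
      simp
    have := intervalIntegral.norm_integral_le_of_norm_le_const (a := (0 : ℝ)) (b := 2 * Real.pi)
      (f := fun y => h x - h y) (C := V) fun y hy => by
        rw [uIoc_of_le hpi.le] at hy
        exact norm_sub_le_integral_norm_deriv hh hc x.2 ⟨hy.1.le, hy.2⟩
    rw [e, norm_smul, Real.norm_of_nonneg hpi.le, sub_zero, abs_of_pos hpi, mul_comm] at this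
    exact le_of_mul_le_mul_right this hpi
  unfold bvNorm
  linarith

lemma sq_integral_norm_le {f : ℝ → ℂ} (hf : Continuous f) :
    (∫ t in (0 : ℝ)..(2 * Real.pi), ‖f t‖) ^ 2 ≤
      2 * Real.pi * ∫ t in (0 : ℝ)..(2 * Real.pi), ‖f t‖ ^ 2 := by
  have hpi := Real.two_pi_pos
  set A := ∫ t in (0 : ℝ)..(2 * Real.pi), ‖f t‖ with hA
  have h := intervalIntegral.integral_nonneg (μ := MeasureTheory.volume)
    (f := fun t => (2 * Real.pi * ‖f t‖ - A) ^ 2) hpi.le fun t _ => sq_nonneg _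
  have e : ∀ t, (2 * Real.pi * ‖f t‖ - A) ^ 2 =
      (2 * Real.pi) ^ 2 * ‖f t‖ ^ 2 - (4 * Real.pi * A) * ‖f t‖ + A ^ 2 := fun t => by ring
  simp_rw [e] at h
  rw [intervalIntegral.integral_add, intervalIntegral.integral_sub,
    intervalIntegral.integral_const_mul, intervalIntegral.integral_const_mul, ← hA] at h
  · simp only [intervalIntegral.integral_const, sub_zero, smul_eq_mul] at h
    have : 0 ≤ 2 * Real.pi * (2 * Real.pi * (∫ t in (0 : ℝ)..(2 * Real.pi), ‖f t‖ ^ 2) - A ^ 2) := by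
      nlinarith
    have := nonneg_of_mul_nonneg_right this hpi
    linarith
  all_goals exact Continuous.intervalIntegrable (by fun_prop) _ _

lemma fCoeff_eq_fourierCoeffOn (f : ℝ → ℂ) (j : ℤ) :
    fCoeff f j = fourierCoeffOn Real.two_pi_pos f j := by
  rw [fourierCoeffOn_eq_integral, fCoeff, Complex.real_smul]
  congr 1
  · push_cast; simp
  · refine intervalIntegral.integral_congr fun x _ => ?_
    simp only [fourier_coe_apply, smul_eq_mul, sub_zero]
    rw [mul_comm]
    congr 2
    have : (Real.pi : ℂ) ≠ 0 := by exact_mod_cast Real.pi_ne_zero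
    push_cast
    field_simp

/-- **Parseval's identity** for continuous functions. -/
lemma hasSum_sq_fCoeff {f : ℝ → ℂ} (hf : Continuous f) :
    HasSum (fun i => ‖fCoeff f i‖ ^ 2)
      ((2 * Real.pi)⁻¹ * ∫ x in (0 : ℝ)..(2 * Real.pi), ‖f x‖ ^ 2) := by
  have hb : ∃ M, ∀ x ∈ Set.Icc (0 : ℝ) (2 * Real.pi), ‖f x‖ ≤ M :=
    isCompact_Icc.exists_bound_of_continuousOn hf.continuousOn
  obtain ⟨M, hM⟩ := hb
  have hL : MeasureTheory.MemLp f 2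
      (MeasureTheory.volume.restrict (Set.Ioc (0 : ℝ) (2 * Real.pi))) := by
    refine MeasureTheory.MemLp.of_bound hf.aestronglyMeasurable M ?_
    filter_upwards [MeasureTheory.ae_restrict_mem measurableSet_Ioc] with x hx
    exact hM x ⟨hx.1.le, hx.2⟩
  simpa [fCoeff_eq_fourierCoeffOn] using hasSum_sq_fourierCoeffOn Real.two_pi_pos hL

lemma exp_int_two_pi (j : ℤ) : Complex.exp (Complex.I * j * (2 * Real.pi)) = 1 := by
  rw [← Complex.exp_int_mul_two_pi_mul_I j]
  congr 1
  ring

lemma hasDerivAt_exp_mul (a : ℂ) (x : ℝ) :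
    HasDerivAt (fun x : ℝ => Complex.exp (a * x)) (a * Complex.exp (a * x)) x := by
  have h : HasDerivAt (fun x : ℝ => a * (x : ℂ)) a x := by
    simpa using (Complex.ofRealCLM.hasDerivAt (x := x)).const_mul a
  simpa [mul_comm] using h.cexp

lemma fCoeff_exp (j k : ℤ) :
    fCoeff (fun x : ℝ => Complex.exp (Complex.I * j * x)) k = if k = j then 1 else 0 := by
  have hpi : (Real.pi : ℂ) ≠ 0 := by exact_mod_cast Real.pi_ne_zero
  have e : ∀ x : ℝ, Complex.exp (Complex.I * j * x) * Complex.exp (-Complex.I * k * x) =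
      Complex.exp ((Complex.I * (j - k)) * x) := fun x => by
    rw [← Complex.exp_add]; congr 1; ring
  simp_rw [fCoeff, e]
  split_ifs with h
  · subst h
    simp only [sub_self, mul_zero, zero_mul, Complex.exp_zero, intervalIntegral.integral_const,
      sub_zero, Complex.real_smul, mul_one]
    push_cast
    field_simp
  · have hne : Complex.I * ((j : ℂ) - k) ≠ 0 := by
      refine mul_ne_zero Complex.I_ne_zero (sub_ne_zero.2 ?_)
      exact_mod_cast Ne.symm h
    rw [integral_exp_mul_complex hne]
    have := exp_int_two_pi (j - k)
    push_cast at this ⊢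
    rw [this]
    simp

/-- Differentiation multiplies the `k`-th Fourier coefficient by `ik`. -/
lemma fCoeff_deriv {h h' : ℝ → ℂ} (hh : ∀ x, HasDerivAt h (h' x) x) (hc : Continuous h')
    (hp : h (2 * Real.pi) = h 0) (k : ℤ) : fCoeff h' k = Complex.I * k * fCoeff h k := by
  have hcont : Continuous h := continuous_iff_continuousAt.2 fun x => (hh x).continuousAt
  have hd : ∀ x : ℝ, HasDerivAt (fun x : ℝ => h x * Complex.exp (-Complex.I * k * x))
      (h' x * Complex.exp (-Complex.I * k * x) -
        Complex.I * k * (h x * Complex.exp (-Complex.I * k * x))) x := fun x => by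
    refine ((hh x).mul (hasDerivAt_exp_mul (-Complex.I * k) x)).congr_deriv ?_
    ring
  have hI := intervalIntegral.integral_eq_sub_of_hasDerivAt
    (a := (0 : ℝ)) (b := 2 * Real.pi) (fun x _ => hd x)
    (Continuous.intervalIntegrable (by fun_prop) _ _)
  rw [intervalIntegral.integral_sub (Continuous.intervalIntegrable (by fun_prop) _ _)
    (Continuous.intervalIntegrable (by fun_prop) _ _),
    intervalIntegral.integral_const_mul, hp] at hI
  have e := exp_int_two_pi (-k)
  have e2 : Complex.exp (-Complex.I * k * ((2 * Real.pi : ℝ) : ℂ)) = 1 := by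
    rw [← e]; congr 1; push_cast; ring
  rw [e2] at hI
  simp only [Complex.ofReal_zero, mul_zero, Complex.exp_zero, sub_self, sub_eq_zero] at hI
  rw [fCoeff, hI, fCoeff]
  ring

/-- A tail bound for two-sided sums dominated by `A / n²`. -/
lemma hasSum_le_of_le_inv_sq {f : ℤ → ℝ} {S A : ℝ} (hf : HasSum f S) (N : ℕ) (hA : 0 ≤ A)
    (h0 : ∀ k : ℤ, |k| ≤ N → f k = 0)
    (h1 : ∀ k : ℤ, (N : ℤ) < |k| → f k ≤ A * ((k : ℝ) ^ 2)⁻¹) : S ≤ 4 * A / (N + 1) := by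
  have h := hf.nat_add_neg
  rw [h0 0 (by simp), add_zero] at h
  refine le_of_tendsto' h.tendsto_sum_nat fun M => ?_
  have hstep : ∀ n ∈ Finset.range M, f n + f (-n) ≤
      if n ∈ Finset.Ioo N M then 2 * A * ((n : ℝ) ^ 2)⁻¹ else 0 := by
    intro n hn
    split_ifs with hm
    · have hN : (N : ℤ) < |(n : ℤ)| := by
        rw [Nat.abs_cast]; exact_mod_cast (Finset.mem_Ioo.1 hm).1
      have a1 := h1 n hN
      have a2 := h1 (-n) (by rwa [abs_neg])
      push_cast at a1 a2
      rw [neg_sq] at a2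
      linarith
    · have hN : |(n : ℤ)| ≤ N := by
        rw [Nat.abs_cast]
        simp only [Finset.mem_Ioo, Finset.mem_range] at hm hn
        omega
      rw [h0 n hN, h0 (-n) (by rwa [abs_neg]), add_zero]
  refine (Finset.sum_le_sum hstep).trans ?_
  rw [← Finset.sum_filter]
  have hset : (Finset.range M).filter (fun n => n ∈ Finset.Ioo N M) = Finset.Ioo N M := by
    ext n; simp only [Finset.mem_filter, Finset.mem_range, Finset.mem_Ioo]; omega
  rw [hset, ← Finset.mul_sum]
  have := sum_Ioo_inv_sq_le (α := ℝ) N M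
  calc _ ≤ 2 * A * (2 / (N + 1)) := by gcongr
    _ = _ := by ring

/-- The trigonometric polynomial `Σ_{|j| ≤ N} c_j e^{ijx}`. -/
noncomputable def trigSum (N : ℕ) (c : ℤ → ℂ) (x : ℝ) : ℂ :=
  ∑ j ∈ Finset.Icc (-(N : ℤ)) (N : ℤ), c j * Complex.exp (Complex.I * (j : ℂ) * (x : ℂ))

/-- The `ℓ²` norm of the coefficients of index at most `N` in absolute value. -/
noncomputable def coeffNorm (N : ℕ) (c : ℤ → ℂ) : ℝ :=
  Real.sqrt (∑ j ∈ Finset.Icc (-(N : ℤ)) (N : ℤ), ‖c j‖ ^ 2)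

lemma hasDerivAt_trigSum (N : ℕ) (c : ℤ → ℂ) (x : ℝ) :
    HasDerivAt (trigSum N c) (trigSum N (fun j => Complex.I * j * c j) x) x := by
  unfold trigSum
  refine HasDerivAt.fun_sum fun j _ => ?_
  refine ((hasDerivAt_exp_mul (Complex.I * j) x).const_mul (c j)).congr_deriv ?_
  ring

lemma continuous_trigSum (N : ℕ) (c : ℤ → ℂ) : Continuous (trigSum N c) := by
  unfold trigSum
  fun_prop

lemma trigSum_const_mul (N : ℕ) (a : ℂ) (c : ℤ → ℂ) (x : ℝ) :
    trigSum N (fun j => a * c j) x = a * trigSum N c x := by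
  simp only [trigSum, Finset.mul_sum, mul_assoc]

lemma trigSum_periodic (N : ℕ) (c : ℤ → ℂ) : Function.Periodic (trigSum N c) (2 * Real.pi) := by
  intro x
  refine Finset.sum_congr rfl fun j _ => ?_
  have : Complex.I * j * ((x + 2 * Real.pi : ℝ) : ℂ) =
      Complex.I * j * x + Complex.I * j * (2 * Real.pi) := by push_cast; ring
  rw [this, Complex.exp_add, exp_int_two_pi, mul_one]

lemma fCoeff_sub {f g : ℝ → ℂ} (hf : Continuous f) (hg : Continuous g) (k : ℤ) :
    fCoeff (fun x => f x - g x) k = fCoeff f k - fCoeff g k := by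
  simp only [fCoeff, sub_mul]
  rw [intervalIntegral.integral_sub (Continuous.intervalIntegrable (by fun_prop) _ _)
    (Continuous.intervalIntegrable (by fun_prop) _ _), mul_sub]

lemma fCoeff_trigSum (N : ℕ) (c : ℤ → ℂ) (k : ℤ) :
    fCoeff (trigSum N c) k = if |k| ≤ N then c k else 0 := by
  have h : fCoeff (trigSum N c) k = ∑ j ∈ Finset.Icc (-(N : ℤ)) (N : ℤ),
      c j * fCoeff (fun x : ℝ => Complex.exp (Complex.I * j * x)) k := by
    simp only [fCoeff, trigSum, Finset.sum_mul]
    rw [intervalIntegral.integral_finsetSum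
      fun j _ => Continuous.intervalIntegrable (by fun_prop) _ _, Finset.mul_sum]
    refine Finset.sum_congr rfl fun j _ => ?_
    simp only [mul_assoc, intervalIntegral.integral_const_mul]
    ring
  rw [h]
  simp only [fCoeff_exp, mul_ite, mul_one, mul_zero, Finset.sum_ite_eq, Finset.mem_Icc, abs_le]

lemma coeffNorm_sq (N : ℕ) (c : ℤ → ℂ) :
    coeffNorm N c ^ 2 = ∑ j ∈ Finset.Icc (-(N : ℤ)) (N : ℤ), ‖c j‖ ^ 2 :=
  Real.sq_sqrt (Finset.sum_nonneg fun _ _ => sq_nonneg _)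

lemma coeffNorm_nonneg (N : ℕ) (c : ℤ → ℂ) : 0 ≤ coeffNorm N c := Real.sqrt_nonneg _

lemma coeffNorm_mono {N : ℕ} {c d : ℤ → ℂ} (h : ∀ j : ℤ, |j| ≤ N → ‖c j‖ ≤ ‖d j‖) :
    coeffNorm N c ≤ coeffNorm N d := by
  refine Real.sqrt_le_sqrt (Finset.sum_le_sum fun j hj => ?_)
  have := h j (abs_le.2 (Finset.mem_Icc.1 hj))
  gcongr

lemma integral_sq_norm_trigSum (N : ℕ) (c : ℤ → ℂ) :
    ∫ x in (0 : ℝ)..(2 * Real.pi), ‖trigSum N c x‖ ^ 2 = 2 * Real.pi * coeffNorm N c ^ 2 := by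
  have h := hasSum_sq_fCoeff (continuous_trigSum N c)
  have h2 : HasSum (fun i => ‖fCoeff (trigSum N c) i‖ ^ 2) (coeffNorm N c ^ 2) := by
    rw [coeffNorm_sq]
    have := hasSum_sum_of_ne_finset_zero (L := SummationFilter.unconditional ℤ)
      (f := fun i => ‖fCoeff (trigSum N c) i‖ ^ 2)
      (s := Finset.Icc (-(N : ℤ)) (N : ℤ)) (by
        intro k hk
        rw [Finset.mem_Icc, ← abs_le] at hk
        simp [fCoeff_trigSum, hk])
    convert this using 1
    refine Finset.sum_congr rfl fun j hj => ?_
    rw [Finset.mem_Icc, ← abs_le] at hj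
    simp [fCoeff_trigSum, hj]
  rw [← h.unique h2]
  field_simp

lemma integral_norm_trigSum_le (N : ℕ) (c : ℤ → ℂ) :
    ∫ x in (0 : ℝ)..(2 * Real.pi), ‖trigSum N c x‖ ≤ 2 * Real.pi * coeffNorm N c := by
  have h := sq_integral_norm_le (continuous_trigSum N c)
  rw [integral_sq_norm_trigSum] at h
  refine abs_le_of_sq_le_sq' ?_ (by have := coeffNorm_nonneg N c; positivity) |>.2
  linarith

lemma norm_le_bvNorm {f : ℝ → ℂ} (hf : Continuous f) {x : ℝ}
    (hx : x ∈ Set.Icc (0 : ℝ) (2 * Real.pi)) : ‖f x‖ ≤ bvNorm f := by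
  have hb : BddAbove (Set.range fun x : Set.Icc (0 : ℝ) (2 * Real.pi) => ‖f (x : ℝ)‖) := by
    obtain ⟨M, hM⟩ := isCompact_Icc.exists_bound_of_continuousOn
      (hf.continuousOn (s := Set.Icc (0 : ℝ) (2 * Real.pi)))
    exact ⟨M, by rintro _ ⟨y, rfl⟩; exact hM y y.2⟩
  have h1 := le_ciSup hb ⟨x, hx⟩
  have h2 : 0 ≤ (eVariationOn f (Set.Icc 0 (2 * Real.pi))).toReal := ENNReal.toReal_nonneg
  unfold bvNorm
  simp only at h1
  linarith

lemma coeffNorm_le_bvNorm (N : ℕ) (c : ℤ → ℂ) : coeffNorm N c ≤ bvNorm (trigSum N c) := by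
  have hpi := Real.two_pi_pos
  have hB : 0 ≤ bvNorm (trigSum N c) :=
    (norm_nonneg _).trans (norm_le_bvNorm (continuous_trigSum N c) (x := 0) ⟨le_rfl, hpi.le⟩)
  have h : ∫ x in (0 : ℝ)..(2 * Real.pi), ‖trigSum N c x‖ ^ 2 ≤
      ∫ x in (0 : ℝ)..(2 * Real.pi), bvNorm (trigSum N c) ^ 2 := by
    refine intervalIntegral.integral_mono_on hpi.le
      (((continuous_trigSum N c).norm.pow 2).intervalIntegrable _ _) (by simp) fun x hx => ?_
    have := norm_le_bvNorm (continuous_trigSum N c) hx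
    gcongr
  rw [integral_sq_norm_trigSum, intervalIntegral.integral_const, smul_eq_mul, sub_zero] at h
  exact abs_le_of_sq_le_sq' (le_of_mul_le_mul_left h hpi) hB |>.2

/-- The oscillatory integral `∫₀ᵀ a(x) φ(v(x)) e^{-ikx} dx` for `φ = Σ_{|j| ≤ N} c_j e^{ijx}`. -/
noncomputable def oscInt (T : ℝ) (v a : ℝ → ℝ) (N : ℕ) (c : ℤ → ℂ) (k : ℤ) : ℂ :=
  ∫ x in (0 : ℝ)..T, (a x : ℂ) * trigSum N c (v x) * Complex.exp (-Complex.I * k * x)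

lemma exp_int_two_pi_mul_nat (k : ℤ) (β : ℕ) :
    Complex.exp (-Complex.I * k * ((2 * Real.pi * β : ℝ) : ℂ)) = 1 := by
  rw [← exp_int_two_pi (-k * β)]
  congr 1
  push_cast
  ring

/-- Integration by parts, letting the derivative fall on the factor `e^{-ikx}`. -/
lemma oscInt_by_parts {β : ℕ} {v w a a' : ℝ → ℝ} (hv : ∀ x, HasDerivAt v (w x) x)
    (hw : Continuous w) (ha : ∀ x, HasDerivAt a (a' x) x) (ha' : Continuous a')
    (hlift : ∀ x : ℝ, v (x + 2 * Real.pi * β) = v x + 2 * Real.pi)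
    (hper : Function.Periodic a (2 * Real.pi * β)) (N : ℕ) (c : ℤ → ℂ) (k : ℤ) :
    Complex.I * k * oscInt (2 * Real.pi * β) v a N c k =
      oscInt (2 * Real.pi * β) v a' N c k +
        oscInt (2 * Real.pi * β) v (fun x => a x * w x) N (fun j => Complex.I * j * c j) k := by
  have hvc : Continuous v := continuous_iff_continuousAt.2 fun x => (hv x).continuousAt
  have hac : Continuous a := continuous_iff_continuousAt.2 fun x => (ha x).continuousAt
  have hφ := fun c => continuous_trigSum N c
  have hd : ∀ x : ℝ, HasDerivAt
      (fun x : ℝ => (a x : ℂ) * trigSum N c (v x) * Complex.exp (-Complex.I * k * x))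
      ((a' x : ℂ) * trigSum N c (v x) * Complex.exp (-Complex.I * k * x) +
        ((a x * w x : ℝ) : ℂ) * trigSum N (fun j => Complex.I * j * c j) (v x) *
          Complex.exp (-Complex.I * k * x) -
        Complex.I * k * ((a x : ℂ) * trigSum N c (v x) * Complex.exp (-Complex.I * k * x))) x := by
    intro x
    have h1 := (hasDerivAt_trigSum N c (v x)).scomp x (hv x)
    refine (((ha x).ofReal_comp.mul h1).mul
      (hasDerivAt_exp_mul (-Complex.I * k) x)).congr_deriv ?_
    simp only [Function.comp, Pi.mul_apply, Complex.real_smul]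
    push_cast
    ring
  have hc : ∀ (b : ℝ → ℝ) (d : ℤ → ℂ), Continuous b → IntervalIntegrable
      (fun x : ℝ => (b x : ℂ) * trigSum N d (v x) * Complex.exp (-Complex.I * k * x))
      MeasureTheory.volume 0 (2 * Real.pi * β) := fun b d hb => by
    have := hφ d
    exact Continuous.intervalIntegrable (by fun_prop) _ _
  have hcw := hc (fun x => a x * w x) (fun j => Complex.I * j * c j) (hac.mul hw)
  have hI := intervalIntegral.integral_eq_sub_of_hasDerivAt
    (a := (0 : ℝ)) (b := 2 * Real.pi * β) (fun x _ => hd x)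
    (((hc _ _ ha').add hcw).sub ((hc _ _ hac).const_mul _))
  rw [intervalIntegral.integral_sub ((hc _ _ ha').add hcw)
      ((hc _ _ hac).const_mul _), intervalIntegral.integral_add (hc _ _ ha') hcw, intervalIntegral.integral_const_mul] at hI
  have e1 := hlift 0
  have e2 := hper 0
  rw [zero_add] at e1 e2
  rw [exp_int_two_pi_mul_nat, e1, e2, trigSum_periodic] at hI
  simp only [Complex.ofReal_zero, mul_zero, Complex.exp_zero, sub_self, sub_eq_zero] at hI
  simp only [oscInt]
  exact hI.symm

lemma oscInt_const_mul (T : ℝ) (v a : ℝ → ℝ) (N : ℕ) (b : ℂ) (c : ℤ → ℂ) (k : ℤ) :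
    oscInt T v a N (fun j => b * c j) k = b * oscInt T v a N c k := by
  simp only [oscInt, trigSum_const_mul]
  rw [← intervalIntegral.integral_const_mul]
  congr 1 with x
  ring

/-- One step of the recursion: either an amplitude derivative is traded for a factor `1/|k|`, or
the amplitude gains a factor `v'` while the coefficient norm does not increase. -/
lemma norm_oscInt_le {β : ℕ} {v w a a' : ℝ → ℝ} (hv : ∀ x, HasDerivAt v (w x) x)
    (hw : Continuous w) (ha : ∀ x, HasDerivAt a (a' x) x) (ha' : Continuous a')
    (hlift : ∀ x : ℝ, v (x + 2 * Real.pi * β) = v x + 2 * Real.pi)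
    (hper : Function.Periodic a (2 * Real.pi * β)) (N : ℕ) (c : ℤ → ℂ) {k : ℤ} (hk : k ≠ 0) :
    ‖oscInt (2 * Real.pi * β) v a N c k‖ ≤
      |(k : ℝ)|⁻¹ * ‖oscInt (2 * Real.pi * β) v a' N c k‖ +
        ‖oscInt (2 * Real.pi * β) v (fun x => a x * w x) N (fun j => (j : ℂ) / k * c j) k‖ := by
  have h := oscInt_by_parts hv hw ha ha' hlift hper N c k
  have hk' : (k : ℂ) ≠ 0 := by exact_mod_cast hk
  have e : (fun j : ℤ => Complex.I * j * c j) =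
      fun j : ℤ => Complex.I * k * ((j : ℂ) / k * c j) := by
    ext j; field_simp
  rw [e, oscInt_const_mul] at h
  have h2 : oscInt (2 * Real.pi * β) v a N c k =
      (Complex.I * k)⁻¹ * oscInt (2 * Real.pi * β) v a' N c k +
        oscInt (2 * Real.pi * β) v (fun x => a x * w x) N (fun j => (j : ℂ) / k * c j) k := by
    have hI := Complex.I_ne_zero
    have : Complex.I * (k : ℂ) ≠ 0 := mul_ne_zero hI hk'
    refine mul_left_cancel₀ this ?_
    rw [h, mul_add, ← mul_assoc, mul_inv_cancel₀ this, one_mul]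
  rw [h2]
  refine (norm_add_le _ _).trans_eq ?_
  rw [norm_mul, norm_inv, norm_mul, Complex.norm_I, one_mul, Complex.norm_intCast]

lemma coeffNorm_div_mul_le {N : ℕ} {k : ℤ} (hk : (N : ℤ) ≤ |k|) (c : ℤ → ℂ) :
    coeffNorm N (fun j => (j : ℂ) / k * c j) ≤ coeffNorm N c := by
  refine coeffNorm_mono fun j hj => ?_
  rw [norm_mul, norm_div, Complex.norm_intCast, Complex.norm_intCast]
  refine mul_le_of_le_one_left (norm_nonneg _) (div_le_one_of_le₀ ?_ (abs_nonneg _))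
  exact_mod_cast hj.trans hk

lemma exists_bound_of_periodic {f : ℝ → ℝ} {T : ℝ} (hT : 0 < T) (hf : Continuous f)
    (hp : Function.Periodic f T) : ∃ M, 0 ≤ M ∧ ∀ x, |f x| ≤ M := by
  obtain ⟨M, hM⟩ := isCompact_Icc.exists_bound_of_continuousOn
    (hf.continuousOn (s := Set.Icc (0 : ℝ) T))
  refine ⟨max M 0, le_max_right _ _, fun x => ?_⟩
  obtain ⟨y, hy, hxy⟩ := hp.exists_mem_Ico₀ hT x
  rw [hxy]
  exact (hM y ⟨hy.1, hy.2.le⟩).trans (le_max_left _ _)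

/-- The trivial bound on the oscillatory integral. -/
lemma exists_norm_oscInt_le_pow {β : ℕ} (hβ : 0 < β) {v w a : ℝ → ℝ}
    (hv : ∀ x, HasDerivAt v (w x) x) (hw : Continuous w) (ha : Continuous a)
    (hlift : ∀ x : ℝ, v (x + 2 * Real.pi * β) = v x + 2 * Real.pi)
    (hper : Function.Periodic a (2 * Real.pi * β))
    (hwper : Function.Periodic w (2 * Real.pi * β)) {q : ℝ} (hq : 0 < q)
    (hwpos : ∀ x, 0 < w x) (hwq : ∀ x, w x ≤ q) :
    ∃ A, 0 ≤ A ∧ ∀ (n N : ℕ) (c : ℤ → ℂ) (k : ℤ),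
      ‖oscInt (2 * Real.pi * β) v (fun x => a x * w x ^ n) N c k‖ ≤ A * q ^ n * coeffNorm N c := by
  have hT : 0 < 2 * Real.pi * β := by have := Real.pi_pos; positivity
  have hvc : Continuous v := continuous_iff_continuousAt.2 fun x => (hv x).continuousAt
  obtain ⟨M, hM0, hM⟩ := exists_bound_of_periodic (f := fun x => a x / w x) hT
    (ha.div hw fun x => (hwpos x).ne') (hper.div hwper)
  refine ⟨M * (2 * Real.pi), by have := Real.pi_pos; positivity, fun n N c k => ?_⟩
  have hφ := continuous_trigSum N c
  have hpt : ∀ x : ℝ, ‖((a x * w x ^ n : ℝ) : ℂ) * trigSum N c (v x) *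
      Complex.exp (-Complex.I * k * x)‖ ≤ M * q ^ n * (‖trigSum N c (v x)‖ * w x) := fun x => by
    have he : ‖Complex.exp (-Complex.I * k * x)‖ = 1 := by
      have : -Complex.I * k * x = ((-k * x : ℝ) : ℂ) * Complex.I := by push_cast; ring
      rw [this, Complex.norm_exp_ofReal_mul_I]
    rw [norm_mul, he, mul_one, norm_mul, Complex.norm_real, Real.norm_eq_abs, abs_mul, abs_pow,
      abs_of_pos (hwpos x)]
    have h1 := hM x
    rw [abs_div, abs_of_pos (hwpos x), div_le_iff₀ (hwpos x)] at h1
    have h2 : w x ^ n ≤ q ^ n := pow_le_pow_left₀ (hwpos x).le (hwq x) n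
    calc |a x| * w x ^ n * ‖trigSum N c (v x)‖ ≤ M * w x * q ^ n * ‖trigSum N c (v x)‖ := by
          gcongr
          · exact pow_nonneg (hwpos x).le n
          · exact mul_nonneg hM0 (hwpos x).le
      _ = _ := by ring
  calc ‖oscInt (2 * Real.pi * β) v (fun x => a x * w x ^ n) N c k‖
      ≤ ∫ x in (0 : ℝ)..(2 * Real.pi * β), M * q ^ n * (‖trigSum N c (v x)‖ * w x) := by
        refine intervalIntegral.norm_integral_le_of_norm_le hT.le
          (Filter.Eventually.of_forall fun x _ => hpt x) ?_
        exact Continuous.intervalIntegrable (by fun_prop) _ _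
    _ = M * q ^ n * ∫ x in (0 : ℝ)..(2 * Real.pi), ‖trigSum N c x‖ := by
        rw [intervalIntegral.integral_const_mul]
        congr 1
        have h := intervalIntegral.integral_comp_mul_deriv (a := 0) (b := 2 * Real.pi * β)
          (f := v) (f' := w) (g := fun y => ‖trigSum N c y‖) (fun x _ => hv x) hw.continuousOn
          hφ.norm
        have e1 := hlift 0
        rw [zero_add] at e1
        have hp : Function.Periodic (fun y => ‖trigSum N c y‖) (2 * Real.pi) := fun x => by
          simp only [trigSum_periodic N c x]
        have h3 := hp.intervalIntegral_add_eq (v 0) 0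
        rw [zero_add] at h3
        rw [← h3, ← e1]
        exact h
    _ ≤ M * q ^ n * (2 * Real.pi * coeffNorm N c) := by
        gcongr
        exact integral_norm_trigSum_le N c
    _ = _ := by ring

lemma oscInt_add {T : ℝ} {v a b : ℝ → ℝ} (hv : Continuous v) (ha : Continuous a)
    (hb : Continuous b) (N : ℕ) (c : ℤ → ℂ) (k : ℤ) :
    oscInt T v (fun x => a x + b x) N c k = oscInt T v a N c k + oscInt T v b N c k := by
  have hφ := continuous_trigSum N c
  simp only [oscInt]
  rw [← intervalIntegral.integral_add (Continuous.intervalIntegrable (by fun_prop) _ _)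
    (Continuous.intervalIntegrable (by fun_prop) _ _)]
  congr 1 with x
  push_cast
  ring

lemma oscInt_const_mul_amplitude (T : ℝ) (v a : ℝ → ℝ) (N : ℕ) (b : ℝ) (c : ℤ → ℂ) (k : ℤ) :
    oscInt T v (fun x => b * a x) N c k = b * oscInt T v a N c k := by
  simp only [oscInt]
  rw [← intervalIntegral.integral_const_mul]
  congr 1 with x
  push_cast
  ring

lemma exists_nat_mul_pow_le {p q : ℝ} (hp : 0 < p) (hpq : p < q) :
    ∃ D, 0 ≤ D ∧ ∀ n : ℕ, (n : ℝ) * p ^ (n - 1) ≤ D * q ^ n := by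
  have hq := hp.trans hpq
  have h := tendsto_self_mul_const_pow_of_lt_one (r := p / q) (by positivity)
    ((div_lt_one hq).2 hpq)
  obtain ⟨D, hD⟩ := h.bddAbove_range
  have hD' : ∀ n : ℕ, (n : ℝ) * (p / q) ^ n ≤ D := fun n => hD ⟨n, rfl⟩
  have hD0 : 0 ≤ D := by simpa using hD' 0
  refine ⟨D / p, by positivity, fun n => ?_⟩
  rcases n with _ | n
  · simp; positivity
  · have := hD' (n + 1)
    rw [div_pow, ← mul_div_assoc, div_le_iff₀ (by positivity)] at this
    rw [Nat.add_sub_cancel, div_mul_eq_mul_div, le_div_iff₀ hp]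
    calc _ = ((n + 1 : ℕ) : ℝ) * p ^ (n + 1) := by ring
      _ ≤ _ := this

lemma deriv_periodic {f : ℝ → ℝ} {T : ℝ} (hf : Function.Periodic f T) :
    Function.Periodic (deriv f) T := by
  intro x
  rw [← deriv_comp_add_const]
  congr 1
  ext y
  exact hf y

/-- Non-stationary phase: the oscillatory integral with a `C^m` amplitude decays like `|k|^{-m}`,
uniformly over trigonometric polynomials of degree at most `|k|`. -/
lemma exists_norm_oscInt_le {β : ℕ} (hβ : 0 < β) {v w : ℝ → ℝ} {r : ℕ}
    (hv : ∀ x, HasDerivAt v (w x) x) (hw : ContDiff ℝ r w)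
    (hlift : ∀ x : ℝ, v (x + 2 * Real.pi * β) = v x + 2 * Real.pi)
    (hwper : Function.Periodic w (2 * Real.pi * β)) {q₀ : ℝ} (hq₀ : 0 < q₀)
    (hwpos : ∀ x, 0 < w x) (hwq : ∀ x, w x ≤ q₀) (m : ℕ) :
    m ≤ r → ∀ a : ℝ → ℝ, ContDiff ℝ m a → Function.Periodic a (2 * Real.pi * β) →
      ∀ q, q₀ < q → q < 1 → ∃ K, 0 ≤ K ∧ ∀ (n N : ℕ) (c : ℤ → ℂ) (k : ℤ), k ≠ 0 → (N : ℤ) ≤ |k| →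
        ‖oscInt (2 * Real.pi * β) v (fun x => a x * w x ^ n) N c k‖ ≤
          K * q ^ n * |(k : ℝ)|⁻¹ ^ m * coeffNorm N c := by
  have hvc : Continuous v := continuous_iff_continuousAt.2 fun x => (hv x).continuousAt
  have hwc : Continuous w := hw.continuous
  induction m with
  | zero =>
    intro _ a ha hper q hq _
    obtain ⟨A, hA, h⟩ := exists_norm_oscInt_le_pow hβ hv hwc ha.continuous hlift hper hwper
      (hq₀.trans hq) hwpos fun x => (hwq x).trans hq.le
    exact ⟨A, hA, fun n N c k _ _ => by simpa using h n N c k⟩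
  | succ m ih =>
    intro hm a ha hper q hq hq1
    have hqpos := hq₀.trans hq
    obtain ⟨p, hp0, hpq⟩ := exists_between hq
    have hppos := hq₀.trans hp0
    have ha1 : ContDiff ℝ 1 a := ha.of_le (by norm_cast; omega)
    have hw1 : ContDiff ℝ 1 w := hw.of_le (by norm_cast; omega)
    have hda : ContDiff ℝ m (deriv a) := (contDiff_succ_iff_deriv.1 (by exact_mod_cast ha)).2.2
    have hdw : ContDiff ℝ m (deriv w) :=
      (contDiff_succ_iff_deriv.1 (by exact_mod_cast hw.of_le (by exact_mod_cast hm))).2.2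
    have haw : ContDiff ℝ m (fun x => a x * deriv w x) :=
      (ha.of_le (by norm_cast; omega)).mul hdw
    obtain ⟨K₁, hK₁, h₁⟩ := ih (by omega) (deriv a) hda (deriv_periodic hper) q hq hq1
    obtain ⟨K₂, hK₂, h₂⟩ := ih (by omega) (fun x => a x * deriv w x) haw
      (hper.mul (deriv_periodic hwper)) p hp0 (hpq.trans hq1)
    obtain ⟨A, hA, h₀⟩ := exists_norm_oscInt_le_pow hβ hv hwc ha.continuous hlift hper hwper
      hqpos hwpos fun x => (hwq x).trans hq.le
    obtain ⟨D, hD, hDn⟩ := exists_nat_mul_pow_le hppos hpq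
    set K₃ := K₁ + K₂ * D with hK₃
    have h1q : 0 < 1 - q := by linarith
    have hK₃0 : 0 ≤ K₃ := by positivity
    have hstep : ∀ (n N : ℕ) (c : ℤ → ℂ) (k : ℤ), k ≠ 0 → (N : ℤ) ≤ |k| →
        ‖oscInt (2 * Real.pi * β) v (fun x => a x * w x ^ n) N c k‖ ≤
          K₃ * q ^ n * |(k : ℝ)|⁻¹ ^ (m + 1) * coeffNorm N c +
          ‖oscInt (2 * Real.pi * β) v (fun x => a x * w x ^ (n + 1)) N
            (fun j => (j : ℂ) / k * c j) k‖ := by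
      intro n N c k hk hN
      have hder : ∀ x, HasDerivAt (fun x => a x * w x ^ n)
          (deriv a x * w x ^ n + n * (a x * deriv w x * w x ^ (n - 1))) x := fun x => by
        have h1 := (ha1.differentiable (by norm_num) x).hasDerivAt
        have h2 := ((hw1.differentiable (by norm_num) x).hasDerivAt).pow n
        refine (h1.mul h2).congr_deriv ?_
        simp only [Pi.pow_apply]
        ring
      have hdac := hda.continuous
      have hdwc := hdw.continuous
      have hac := ha.continuous
      have h := norm_oscInt_le hv hwc hder (by fun_prop) hlift
        (hper.mul (hwper.comp (· ^ n))) N c hk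
      simp only [mul_assoc, ← pow_succ] at h ⊢
      refine h.trans (add_le_add_left ?_ _)
      rw [oscInt_add hvc (by fun_prop) (by fun_prop), oscInt_const_mul_amplitude]
      have e₁ := h₁ n N c k hk hN
      have e₂ := h₂ (n - 1) N c k hk hN
      simp only [mul_assoc] at e₁ e₂
      have hQ := coeffNorm_nonneg N c
      have hnorm : ‖((n : ℝ) : ℂ)‖ = n := by simp
      calc |(k : ℝ)|⁻¹ * ‖oscInt (2 * (Real.pi * β)) v (fun x => deriv a x * w x ^ n) N c k +
            ((n : ℝ) : ℂ) * oscInt (2 * (Real.pi * β)) v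
              (fun x => a x * (deriv w x * w x ^ (n - 1))) N c k‖
          ≤ |(k : ℝ)|⁻¹ * (K₁ * (q ^ n * (|(k : ℝ)|⁻¹ ^ m * coeffNorm N c)) +
              n * (K₂ * (p ^ (n - 1) * (|(k : ℝ)|⁻¹ ^ m * coeffNorm N c)))) := by
            gcongr
            refine (norm_add_le _ _).trans ?_
            rw [norm_mul, hnorm]
            gcongr
        _ = |(k : ℝ)|⁻¹ ^ (m + 1) * coeffNorm N c *
              (K₁ * q ^ n + K₂ * (n * p ^ (n - 1))) := by ring
        _ ≤ |(k : ℝ)|⁻¹ ^ (m + 1) * coeffNorm N c * (K₁ * q ^ n + K₂ * (D * q ^ n)) := by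
            exact mul_le_mul_of_nonneg_left (add_le_add_right
              (mul_le_mul_of_nonneg_left (hDn n) hK₂) _) (by positivity)
        _ = _ := by rw [hK₃]; ring
    have hiter : ∀ (M n N : ℕ) (c : ℤ → ℂ) (k : ℤ), k ≠ 0 → (N : ℤ) ≤ |k| →
        ‖oscInt (2 * Real.pi * β) v (fun x => a x * w x ^ n) N c k‖ ≤
          (K₃ / (1 - q) * q ^ n * |(k : ℝ)|⁻¹ ^ (m + 1) + A * q ^ (n + M)) * coeffNorm N c := by
      intro M
      induction M with
      | zero =>
        intro n N c k hk hN
        have hQ := coeffNorm_nonneg N c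
        refine (h₀ n N c k).trans ?_
        rw [add_zero, add_mul]
        exact le_add_of_nonneg_left (by positivity)
      | succ M ihM =>
        intro n N c k hk hN
        refine (hstep n N c k hk hN).trans ?_
        have h1 := ihM (n + 1) N (fun j => (j : ℂ) / k * c j) k hk hN
        have h2 := coeffNorm_div_mul_le hN c
        calc _ ≤ K₃ * q ^ n * |(k : ℝ)|⁻¹ ^ (m + 1) * coeffNorm N c +
              (K₃ / (1 - q) * q ^ (n + 1) * |(k : ℝ)|⁻¹ ^ (m + 1) + A * q ^ (n + 1 + M)) *
                coeffNorm N c := by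
              gcongr
              exact h1.trans (by gcongr)
          _ = _ := by
              field_simp
              ring
    refine ⟨K₃ / (1 - q), by positivity, fun n N c k hk hN => ?_⟩
    have hlim : Filter.Tendsto (fun M : ℕ => (K₃ / (1 - q) * q ^ n * |(k : ℝ)|⁻¹ ^ (m + 1) +
        A * q ^ (n + M)) * coeffNorm N c) Filter.atTop
        (nhds ((K₃ / (1 - q) * q ^ n * |(k : ℝ)|⁻¹ ^ (m + 1) + A * (q ^ n * 0)) *
          coeffNorm N c)) := by
      simp only [pow_add q n]
      exact (((tendsto_pow_atTop_nhds_zero_of_lt_one hqpos.le hq1).const_mul _).const_mul _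
        |>.const_add _).mul_const _
    rw [mul_zero, mul_zero, add_zero] at hlim
    exact ge_of_tendsto' hlim fun M => hiter M n N c k hk hN

lemma deriv_periodic_of_lift {v : ℝ → ℝ} {T s : ℝ} (hlift : ∀ x, v (x + T) = v x + s) :
    Function.Periodic (deriv v) T := by
  intro x
  rw [← deriv_comp_add_const]
  simp only [hlift, deriv_add_const]

lemma contDiff_trigSum (N : ℕ) (c : ℤ → ℂ) : ContDiff ℝ 1 (trigSum N c) := by
  refine contDiff_one_iff_deriv.2 ⟨fun x => (hasDerivAt_trigSum N c x).differentiableAt, ?_⟩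
  have : deriv (trigSum N c) = trigSum N (fun j => Complex.I * j * c j) :=
    funext fun x => (hasDerivAt_trigSum N c x).deriv
  rw [this]
  exact continuous_trigSum N _

lemma contDiff_transferOp {β : ℕ} {v : ℝ → ℝ} {φ : ℝ → ℂ} (hv : ContDiff ℝ 1 v)
    (hw : ContDiff ℝ 1 (deriv v)) (hφ : ContDiff ℝ 1 φ) :
    ContDiff ℝ 1 (transferOp β v φ) := by
  unfold transferOp
  refine ContDiff.sum fun b _ => ContDiff.mul ?_ ?_
  · exact Complex.ofRealCLM.contDiff.comp (hw.comp (contDiff_id.add contDiff_const))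
  · exact hφ.comp (hv.comp (contDiff_id.add contDiff_const))

lemma transferOp_two_pi {β : ℕ} {v : ℝ → ℝ} {φ : ℝ → ℂ}
    (hlift : ∀ x : ℝ, v (x + 2 * Real.pi * β) = v x + 2 * Real.pi)
    (hwper : Function.Periodic (deriv v) (2 * Real.pi * β))
    (hφ : Function.Periodic φ (2 * Real.pi)) :
    transferOp β v φ (2 * Real.pi) = transferOp β v φ 0 := by
  set F : ℕ → ℂ := fun b =>
    (Complex.ofReal (deriv v (2 * Real.pi * b))) * φ (v (2 * Real.pi * b)) with hF
  have h1 : transferOp β v φ (2 * Real.pi) = ∑ b ∈ Finset.range β, F (b + 1) := by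
    refine Finset.sum_congr rfl fun b _ => ?_
    have : 2 * Real.pi + 2 * Real.pi * b = 2 * Real.pi * ((b + 1 : ℕ) : ℝ) := by push_cast; ring
    rw [this]
  have h2 : transferOp β v φ 0 = ∑ b ∈ Finset.range β, F b := by
    refine Finset.sum_congr rfl fun b _ => ?_
    rw [zero_add]
  have h3 : F β = F 0 := by
    have e1 := hlift 0
    have e2 := hwper 0
    rw [zero_add] at e1 e2
    simp only [hF, e1, e2, hφ (v 0), Nat.cast_zero, mul_zero]
  have h4 := Finset.sum_range_succ F β
  rw [Finset.sum_range_succ', h3] at h4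
  rw [h1, h2]
  exact add_right_cancel h4

/-- The Fourier coefficients of `L φ` are oscillatory integrals over the `β`-fold cover. -/
lemma fCoeff_transferOp {β : ℕ} {v : ℝ → ℝ} (hv : Continuous v) (hw : Continuous (deriv v))
    (N : ℕ) (c : ℤ → ℂ) (k : ℤ) :
    fCoeff (transferOp β v (trigSum N c)) k =
      (1 / (2 * Real.pi) : ℂ) * oscInt (2 * Real.pi * β) v (deriv v) N c k := by
  have hφ := continuous_trigSum N c
  set F : ℝ → ℂ := fun x =>
    Complex.ofReal (deriv v x) * trigSum N c (v x) * Complex.exp (-Complex.I * k * x) with hF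
  have hFc : Continuous F := by fun_prop
  have h1 : ∀ x : ℝ, transferOp β v (trigSum N c) x * Complex.exp (-Complex.I * k * x) =
      ∑ b ∈ Finset.range β, F (x + 2 * Real.pi * b) := fun x => by
    rw [transferOp, Finset.sum_mul]
    refine Finset.sum_congr rfl fun b _ => ?_
    have : Complex.exp (-Complex.I * k * ((x + 2 * Real.pi * b : ℝ) : ℂ)) =
        Complex.exp (-Complex.I * k * x) := by
      rw [Complex.ofReal_add, mul_add, Complex.exp_add, exp_int_two_pi_mul_nat, mul_one]
    simp only [hF, this]
  have h2 := intervalIntegral.sum_integral_adjacent_intervals (f := F)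
    (μ := MeasureTheory.volume) (a := fun b : ℕ => 2 * Real.pi * b) (n := β)
    fun b _ => hFc.intervalIntegrable _ _
  simp only [Nat.cast_zero, mul_zero] at h2
  simp only [fCoeff, h1, oscInt]
  rw [← h2, intervalIntegral.integral_finsetSum
    fun b _ => Continuous.intervalIntegrable (by fun_prop) _ _]
  congr 1
  refine Finset.sum_congr rfl fun b _ => ?_
  rw [intervalIntegral.integral_comp_add_right]
  congr 1
  · ring
  · push_cast; ring

/-- The BV error of the Fourier truncation of a `C¹` function with coefficients of size
`M |k|^{-r}`. -/
lemma bvNorm_sub_trigSum_le {g : ℝ → ℂ} (hg : ContDiff ℝ 1 g) (hper : g (2 * Real.pi) = g 0)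
    {r N : ℕ} (hr : 2 ≤ r) {M : ℝ} (hM : 0 ≤ M)
    (hcoeff : ∀ k : ℤ, (N : ℤ) < |k| → ‖fCoeff g k‖ ≤ M * |(k : ℝ)|⁻¹ ^ r) :
    bvNorm (fun x => g x - trigSum N (fCoeff g) x) ≤
      8 * Real.pi * M * ((1 + (N : ℝ)) * Real.sqrt (1 + N)) * (1 + (N : ℝ))⁻¹ ^ r := by
  have hpi := Real.two_pi_pos
  set h : ℝ → ℂ := fun x => g x - trigSum N (fCoeff g) x with hh
  have hC1 : ContDiff ℝ 1 h := hg.sub (contDiff_trigSum N _)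
  have hd : ∀ x, HasDerivAt h (deriv h x) x := fun x =>
    (hC1.differentiable (by norm_num) x).hasDerivAt
  have hc : Continuous (deriv h) := hC1.continuous_deriv (by norm_num)
  have hhc : ∀ k, fCoeff h k = if |k| ≤ (N : ℤ) then 0 else fCoeff g k := fun k => by
    rw [hh, fCoeff_sub hg.continuous (continuous_trigSum N _), fCoeff_trigSum]
    split_ifs <;> simp
  have hh0 : ∫ x in (0 : ℝ)..(2 * Real.pi), h x = 0 := by
    have h0 := hhc 0
    have : (Real.pi : ℂ) ≠ 0 := by exact_mod_cast Real.pi_ne_zero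
    simpa [fCoeff, this] using h0
  have hhper : h (2 * Real.pi) = h 0 := by
    have := trigSum_periodic N (fCoeff g) 0
    rw [zero_add] at this
    simp only [hh, hper, this]
  have hsum := hasSum_sq_fCoeff hc
  simp only [fCoeff_deriv hd hc hhper, norm_mul, Complex.norm_I, one_mul,
    Complex.norm_intCast] at hsum
  set E := M * (1 + (N : ℝ))⁻¹ ^ (r - 2) with hE
  have hE0 : 0 ≤ E := by positivity
  have hS := hasSum_le_of_le_inv_sq hsum N (A := E ^ 2) (by positivity)
    (fun k hk => by simp [hhc, hk]) (fun k hk => by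
      have hkN : 1 + (N : ℝ) ≤ |(k : ℝ)| := by
        have : (N : ℤ) + 1 ≤ |k| := hk
        have : (N : ℝ) + 1 ≤ |(k : ℝ)| := by exact_mod_cast this
        linarith
      have hk0 : 0 < |(k : ℝ)| := by have : (0 : ℝ) ≤ N := N.cast_nonneg; linarith
      rw [hhc, if_neg (not_le.2 hk), ← sq_abs (k : ℝ), ← inv_pow, ← mul_pow]
      refine pow_le_pow_left₀ (by positivity) ?_ 2
      calc |(k : ℝ)| * ‖fCoeff g k‖ ≤ |(k : ℝ)| * (M * |(k : ℝ)|⁻¹ ^ r) := by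
            gcongr
            exact hcoeff k hk
        _ = M * |(k : ℝ)|⁻¹ ^ (r - 2) * |(k : ℝ)|⁻¹ := by
            obtain ⟨s, rfl⟩ := Nat.exists_eq_add_of_le' hr
            rw [Nat.add_sub_cancel, pow_add]
            field_simp
        _ ≤ E * |(k : ℝ)|⁻¹ := by
            rw [hE]
            gcongr)
  set W := ∫ x in (0 : ℝ)..(2 * Real.pi), ‖deriv h x‖ with hW
  have hsq : W ^ 2 ≤ (4 * Real.pi * E / Real.sqrt (1 + N)) ^ 2 := by
    refine (sq_integral_norm_le hc).trans ?_
    rw [div_pow, Real.sq_sqrt (by positivity)]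
    calc 2 * Real.pi * ∫ x in (0 : ℝ)..(2 * Real.pi), ‖deriv h x‖ ^ 2
        = (2 * Real.pi) ^ 2 *
          ((2 * Real.pi)⁻¹ * ∫ x in (0 : ℝ)..(2 * Real.pi), ‖deriv h x‖ ^ 2) := by
          field_simp
      _ ≤ (2 * Real.pi) ^ 2 * (4 * E ^ 2 / (N + 1)) := by gcongr
      _ = _ := by rw [add_comm (N : ℝ) 1]; ring
  have hWle : W ≤ 4 * Real.pi * E / Real.sqrt (1 + N) :=
    (abs_le_of_sq_le_sq' hsq (by have := Real.pi_pos; positivity)).2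
  calc bvNorm h ≤ 2 * W := bvNorm_le_integral_norm_deriv hd hc hh0
    _ ≤ 2 * (4 * Real.pi * E / Real.sqrt (1 + N)) := by gcongr
    _ = _ := by
      obtain ⟨s, rfl⟩ := Nat.exists_eq_add_of_le' hr
      have h1 : Real.sqrt (1 + N) ^ 2 = 1 + (N : ℝ) := Real.sq_sqrt (by positivity)
      have h2 : Real.sqrt (1 + N) ≠ 0 := (Real.sqrt_pos.2 (by positivity)).ne'
      have h3 : (1 + (N : ℝ)) ≠ 0 := by positivity
      rw [hE, Nat.add_sub_cancel, pow_add]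
      rw [inv_pow, inv_pow]
      field_simp
      linear_combination -8 * M * h1

/-- For a `C^{r+1}` uniformly expanding degree-`β` circle map satisfying
the generalized distortion condition (DD_r), the Fourier--Galerkin truncation error of the
transfer operator satisfies `‖Lφ - P_N(Lφ)‖_BV ≤ C N^{3/2} (1+N)^{-r} ‖φ‖_BV` for every
trigonometric polynomial `φ` of degree at most `N`. -/
theorem truncation_error_differentiable
    (β : ℕ) (hβ : 2 ≤ β) (lam : ℝ) (hlam : 1 < lam) (r : ℕ) (hr : 2 ≤ r)
    (v : ℝ → ℝ) (hv : ContDiff ℝ (r + 1 : ℕ) v)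
    (hlift : ∀ x : ℝ, v (x + 2 * Real.pi * β) = v x + 2 * Real.pi)
    (hd : ∀ x : ℝ, 0 < deriv v x ∧ deriv v x ≤ lam⁻¹)
    (C : ℕ → ℝ)
    (hC : ∀ n, 1 ≤ n → n ≤ r → ∀ x : ℝ,
      |iteratedDeriv (n + 1) v x| ≤ C n * |deriv v x|) :
    ∃ Cb > (0 : ℝ),
      ∀ N : ℕ, 1 ≤ N → ∀ φ : ℝ → ℂ, IsTrigPoly N φ →
        bvNorm (fun x => transferOp β v φ x - fTrunc N (transferOp β v φ) x) ≤
          Cb * ((N : ℝ) * Real.sqrt N) * (1 + (N : ℝ))⁻¹ ^ r * bvNorm φ := by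
  have hpi := Real.two_pi_pos
  have hvr : ContDiff ℝ ((r : WithTop ℕ∞) + 1) v := by exact_mod_cast hv
  have hw : ContDiff ℝ r (deriv v) := (contDiff_succ_iff_deriv.1 hvr).2.2
  have hvd : ∀ x, HasDerivAt v (deriv v x) x := fun x =>
    ((contDiff_succ_iff_deriv.1 hvr).1 x).hasDerivAt
  have hv1 : ContDiff ℝ 1 v := hv.of_le (by norm_cast; omega)
  have hw1 : ContDiff ℝ 1 (deriv v) := hw.of_le (by norm_cast; omega)
  have hwper := deriv_periodic_of_lift hlift
  obtain ⟨q, hq, hq1⟩ := exists_between (inv_lt_one_of_one_lt₀ hlam)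
  obtain ⟨K, hK, hosc⟩ := exists_norm_oscInt_le (by omega) hvd hw hlift hwper
    (inv_pos.2 (one_pos.trans hlam)) (fun x => (hd x).1) (fun x => (hd x).2) r le_rfl
    (deriv v) hw hwper q hq hq1
  refine ⟨16 * K + 1, by positivity, ?_⟩
  rintro N hN φ ⟨c, rfl⟩
  change bvNorm (fun x => transferOp β v (trigSum N c) x -
    trigSum N (fCoeff (transferOp β v (trigSum N c))) x) ≤
      (16 * K + 1) * ((N : ℝ) * Real.sqrt N) * (1 + (N : ℝ))⁻¹ ^ r * bvNorm (trigSum N c)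
  have hQ := coeffNorm_nonneg N c
  have hg : ContDiff ℝ 1 (transferOp β v (trigSum N c)) :=
    contDiff_transferOp hv1 hw1 (contDiff_trigSum N c)
  have hcoeff : ∀ k : ℤ, (N : ℤ) < |k| → ‖fCoeff (transferOp β v (trigSum N c)) k‖ ≤
      (2 * Real.pi)⁻¹ * K * coeffNorm N c * |(k : ℝ)|⁻¹ ^ r := fun k hk => by
    have hk0 : k ≠ 0 := by rintro rfl; simp at hk; omega
    have h := hosc 0 N c k hk0 hk.le
    simp only [pow_zero, mul_one] at h
    rw [fCoeff_transferOp hv1.continuous hw1.continuous, norm_mul]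
    have e : ‖(1 / (2 * Real.pi) : ℂ)‖ = (2 * Real.pi)⁻¹ := by
      rw [one_div, norm_inv, norm_mul, Complex.norm_real, Real.norm_of_nonneg Real.pi_pos.le]
      simp
    rw [e]
    calc _ ≤ (2 * Real.pi)⁻¹ * (K * |(k : ℝ)|⁻¹ ^ r * coeffNorm N c) := by gcongr
      _ = _ := by ring
  have h := bvNorm_sub_trigSum_le hg (transferOp_two_pi hlift hwper (trigSum_periodic N c)) hr
    (M := (2 * Real.pi)⁻¹ * K * coeffNorm N c) (by positivity) hcoeff
  refine h.trans ?_
  have hN1 : (1 : ℝ) ≤ N := by exact_mod_cast hN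
  have hs : Real.sqrt (1 + N) ≤ 2 * Real.sqrt N := by
    rw [Real.sqrt_le_left (by positivity), mul_pow, Real.sq_sqrt (by positivity)]
    linarith
  have hB := coeffNorm_le_bvNorm N c
  calc 8 * Real.pi * ((2 * Real.pi)⁻¹ * K * coeffNorm N c) *
        ((1 + (N : ℝ)) * Real.sqrt (1 + N)) * (1 + (N : ℝ))⁻¹ ^ r
      = 4 * K * ((1 + (N : ℝ)) * Real.sqrt (1 + N)) * (1 + (N : ℝ))⁻¹ ^ r * coeffNorm N c := by
        field_simp
        ring
    _ ≤ 4 * K * ((2 * N) * (2 * Real.sqrt N)) * (1 + (N : ℝ))⁻¹ ^ r * bvNorm (trigSum N c) := by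
        gcongr
        linarith
    _ = 16 * K * (N * Real.sqrt N) * (1 + (N : ℝ))⁻¹ ^ r * bvNorm (trigSum N c) := by ring
    _ ≤ _ := by
        have := hQ.trans hB
        gcongr
        linarith
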